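/- For any state I : Σ^n → {0,1} supported on wildcard-free strings, the result of the full Merge pass M = M_n ∘ ⋯ ∘ M_1 (I) satisfies, for every u with w ≥ 1 wildcards: M(u) = 1 if and only if there exist s, t ∈ Σ^n with w−1 wildcards each whose merge is u and M(s) = M(t) = 1. -/

import Mathlib

abbrev MTerm (n : ℕ) := Fin n → Option Bool

abbrev QState (n : ℕ) := MTerm n → Bool

/-- number of wildcards of a minterm -/
def wcount {n : ℕ} (u : MTerm n) : ℕ :=
  (Finset.univ.filter (fun i : Fin n => u i = none)).card

/-- The `Merge` transform across dimension `i`. -/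
def MergeDim {n : ℕ} (i : Fin n) (S : QState n) : QState n :=
  fun u =>
    if u i = none then
      S u || (S (Function.update u i (some false)) && S (Function.update u i (some true)))
    else S u

/-- Every wildcard-free instance of `u` lies in the support of `I`. -/
def Covered {n : ℕ} (I : QState n) (u : MTerm n) : Prop :=
  ∀ v : MTerm n, (∀ i, v i ≠ none) → (∀ i, u i ≠ none → v i = u i) → I v = true

theorem covered_iff_of_forall_ne_none {n : ℕ} {I : QState n} {u : MTerm n}
    (hu : ∀ i, u i ≠ none) : Covered I u ↔ I u = true := by
  refine ⟨fun h => h u hu fun _ _ => rfl, fun h v _ hvu => ?_⟩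
  have : v = u := funext fun i => hvu i (hu i)
  rwa [this]

theorem covered_iff_update {n : ℕ} {I : QState n} {u : MTerm n} {i : Fin n} (hi : u i = none) :
    Covered I u ↔ Covered I (Function.update u i (some false)) ∧
      Covered I (Function.update u i (some true)) := by
  constructor
  · intro h
    constructor <;>
    · refine fun v hv hvu => h v hv fun j hj => ?_
      have hji : j ≠ i := fun e => hj (e ▸ hi)
      simpa [hji, hj] using hvu j
  · rintro ⟨h0, h1⟩ v hv hvu
    cases hb : v i with
    | none => exact absurd hb (hv i)
    | some b =>
      cases b
      · refine h0 v hv fun j hj => ?_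
        by_cases hji : j = i
        · simp [hji, hb]
        · simp only [Function.update_of_ne hji] at hj ⊢
          exact hvu j hj
      · refine h1 v hv fun j hj => ?_
        by_cases hji : j = i
        · simp [hji, hb]
        · simp only [Function.update_of_ne hji] at hj ⊢
          exact hvu j hj

theorem foldl_mergeDim_eq_true_iff {n : ℕ} {I : QState n}
    (hI : ∀ u : MTerm n, (∃ i : Fin n, u i = none) → I u = false) (l : List (Fin n))
    (u : MTerm n) :
    l.foldl (fun S i => MergeDim i S) I u = true ↔
      (∀ i, u i = none → i ∈ l) ∧ Covered I u := by
  induction l using List.reverseRecOn generalizing u with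
  | nil =>
    by_cases hu : ∃ i, u i = none
    · have := hI u hu
      obtain ⟨i, hi⟩ := hu
      simp only [List.foldl_nil, this, Bool.false_eq_true, false_iff]
      exact fun h => by simpa using h.1 i hi
    · push Not at hu
      simp [covered_iff_of_forall_ne_none hu, hu]
  | append_singleton l i ih =>
    simp only [List.foldl_append, List.foldl_cons, List.foldl_nil, MergeDim]
    split_ifs with hi
    · have hmem (b : Bool) : (∀ j, Function.update u i (some b) j = none → j ∈ l) ↔
          ∀ j, u j = none → j ∈ l ++ [i] := by
        refine forall_congr' fun j => ?_
        by_cases hji : j = i <;> simp [hji]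
      simp only [Bool.or_eq_true, Bool.and_eq_true, ih, hmem]
      rw [covered_iff_update hi]
      have : (∀ j, u j = none → j ∈ l) → ∀ j, u j = none → j ∈ l ++ [i] :=
        fun h j hj => List.mem_append_left _ (h j hj)
      tauto
    · rw [ih]
      refine and_congr_left fun _ => forall_congr' fun j => ?_
      by_cases hji : j = i <;> simp [hji, hi]

theorem wcount_update_some {n : ℕ} {u : MTerm n} {i : Fin n} (hi : u i = none) (b : Bool) :
    wcount (Function.update u i (some b)) = wcount u - 1 := by
  unfold wcount
  rw [← Finset.card_erase_of_mem (a := i) (by simp [hi])]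
  congr 1
  ext j
  by_cases hji : j = i <;> simp [hji]

/-- For a state `I` supported on wildcard-free strings, after a full Merge pass
`M = M_n ∘ ⋯ ∘ M_1 (I)` (in any order), for every string `u` with `w ≥ 1` wildcards:
`M(u) = 1` iff `u` is the merge of two strings `s`, `t` with `w − 1` wildcards each and
`M(s) = M(t) = 1`. -/
theorem stmt_19 {n : ℕ} (I : QState n)
    (hI : ∀ u : MTerm n, (∃ i : Fin n, u i = none) → I u = false)
    (l : List (Fin n)) (hnd : l.Nodup) (hall : ∀ i : Fin n, i ∈ l) :
    ∀ u : MTerm n, ∀ w : ℕ, wcount u = w → 1 ≤ w →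
      ((l.foldl (fun S i => MergeDim i S) I) u = true ↔
        ∃ (s t : MTerm n) (i : Fin n),
          wcount s = w - 1 ∧ wcount t = w - 1 ∧
          s i = some false ∧ t i = some true ∧
          t = Function.update s i (some true) ∧
          u = Function.update s i none ∧
          (l.foldl (fun S i => MergeDim i S) I) s = true ∧
          (l.foldl (fun S i => MergeDim i S) I) t = true) := by
  intro u w hw hw1
  have key (x : MTerm n) : l.foldl (fun S i => MergeDim i S) I x = true ↔ Covered I x := by
    simp [foldl_mergeDim_eq_true_iff hI, hall]
  simp only [key]
  constructor
  · intro h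
    obtain ⟨i, hi⟩ : ∃ i, u i = none := by
      obtain ⟨i, hi⟩ := Finset.card_pos.mp (show 0 < wcount u by omega)
      exact ⟨i, by simpa using hi⟩
    obtain ⟨h0, h1⟩ := (covered_iff_update hi).mp h
    refine ⟨Function.update u i (some false), Function.update u i (some true), i,
      ?_, ?_, by simp, by simp, by simp, ?_, h0, h1⟩
    · rw [wcount_update_some hi, hw]
    · rw [wcount_update_some hi, hw]
    · rw [Function.update_idem, ← hi, Function.update_eq_self]
  · rintro ⟨s, t, i, -, -, hs, -, rfl, rfl, h0, h1⟩
    rw [covered_iff_update (i := i) (by simp)]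
    simp only [Function.update_idem]
    rw [← hs, Function.update_eq_self]
    exact ⟨h0, h1⟩
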